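/- If K is an infinite field, then for every non-constant polynomial f ∈ K[T] there exists a polynomial g ∈ K[T], coprime to f, such that g/f is normal; that is, the polynomial analogue of Zaremba's conjecture holds with bound 1 on the degrees of the partial quotients over every infinite field. -/

import Mathlib

noncomputable section

namespace PaperCF

variable {K : Type*} [Field K]

/-- The element `T` of `K((T⁻¹))`, where `K((T⁻¹))` is modeled as the field
`LaurentSeries K` of Laurent series in the variable `t = T⁻¹`. -/
def Tvar (K : Type*) [Field K] : LaurentSeries K := (HahnSeries.single (-1 : ℤ) (1 : K))

/-- The embedding of `K[T]` into `K((T⁻¹))`, sending the polynomial variable to `T = t⁻¹`. -/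
def emb : Polynomial K →+* LaurentSeries K := (Polynomial.aeval (Tvar K)).toRingHom

/-- The polynomial part `⌊α⌋` of a formal Laurent series `α ∈ K((T⁻¹))`. -/
def polyPart (α : LaurentSeries K) : Polynomial K :=
  ∑ i ∈ Finset.range ((-α.order).toNat + 1), Polynomial.monomial i (α.coeff (-(i : ℤ)))

/-- The complete quotients `αₙ` of the regular continued fraction expansion of `α`
(with the convention `0⁻¹ = 0`, so that `cq α n = 0` for all `n` past the end of a
finite expansion). -/
def cq (α : LaurentSeries K) : ℕ → LaurentSeries K
  | 0 => α
  | n + 1 => (cq α n - emb (polyPart (cq α n)))⁻¹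

/-- The partial quotients `aₙ = ⌊αₙ⌋` of the regular continued fraction expansion of `α`. -/
def pq (α : LaurentSeries K) (n : ℕ) : Polynomial K := polyPart (cq α n)

/-- The continuants `(pₙ, qₙ)` of the regular continued fraction expansion of `α`. -/
def cont (α : LaurentSeries K) : ℕ → Polynomial K × Polynomial K
  | 0 => (pq α 0, 1)
  | 1 => (pq α 1 * pq α 0 + 1, pq α 1)
  | n + 2 => (pq α (n + 2) * (cont α (n + 1)).1 + (cont α n).1,
              pq α (n + 2) * (cont α (n + 1)).2 + (cont α n).2)

/-- `pₙ`. -/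
def contP (α : LaurentSeries K) (n : ℕ) : Polynomial K := (cont α n).1

/-- `qₙ`. -/
def contQ (α : LaurentSeries K) (n : ℕ) : Polynomial K := (cont α n).2

/-- The `n`-th partial quotient (and hence the `n`-th convergent) of `α` genuinely exists. -/
def ConvAt (α : LaurentSeries K) (n : ℕ) : Prop := n = 0 ∨ cq α n ≠ 0

/-- `K(α) = sup_{n ≥ 1} deg aₙ`, as an extended natural number. -/
def KK (α : LaurentSeries K) : ℕ∞ :=
  ⨆ n : {n : ℕ // 1 ≤ n ∧ cq α n ≠ 0}, ((pq α n.1).natDegree : ℕ∞)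

/-- `ōK(α) = limsup_n deg aₙ`. -/
def KKbar (α : LaurentSeries K) : ℕ∞ :=
  Filter.limsup (fun n => ((pq α n).natDegree : ℕ∞)) Filter.atTop

/-- `α` is a rational function, i.e. an element of `K(T) ⊆ K((T⁻¹))`. -/
def IsRat (α : LaurentSeries K) : Prop :=
  ∃ p q : Polynomial K, q ≠ 0 ∧ α * emb q = emb p

/-- Two Laurent series are equivalent if they differ by a Möbius transformation with
matrix in `GL₂(K[T])`. -/
def MEquiv (α β : LaurentSeries K) : Prop :=
  ∃ a b c d : Polynomial K, IsUnit (a * d - b * c) ∧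
    emb c * α + emb d ≠ 0 ∧ β = (emb a * α + emb b) / (emb c * α + emb d)

end PaperCF

namespace PaperCF

variable {K : Type*} [Field K]

open Polynomial

lemma emb_monomial (n : ℕ) (a : K) :
    emb (monomial n a) = HahnSeries.single (-(n : ℤ)) a := by
  change aeval (Tvar K) (monomial n a) = _
  rw [aeval_monomial, Tvar, HahnSeries.single_pow, HahnSeries.algebraMap_apply',
    ← PowerSeries.C_eq_algebraMap, HahnSeries.ofPowerSeries_C, HahnSeries.C_apply,
    HahnSeries.single_mul_single]
  simp

lemma coeff_emb (p : K[X]) (j : ℤ) :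
    (emb p).coeff j = if j ≤ 0 then p.coeff (-j).toNat else 0 := by
  induction p using Polynomial.induction_on' with
  | add p q hp hq =>
    rw [map_add, HahnSeries.coeff_add, hp, hq]
    split_ifs <;> simp
  | monomial n a =>
    rw [emb_monomial, HahnSeries.coeff_single, coeff_monomial]
    split_ifs <;> first | rfl | omega

lemma coeff_polyPart (α : LaurentSeries K) (i : ℕ) :
    (polyPart α).coeff i = α.coeff (-(i : ℤ)) := by
  simp only [polyPart, finsetSum_coeff, coeff_monomial, Finset.sum_ite_eq', Finset.mem_range]
  split_ifs with h
  · rfl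
  · exact (HahnSeries.coeff_eq_zero_of_lt_order (by omega)).symm

lemma emb_ne_zero {p : K[X]} (hp : p ≠ 0) : emb p ≠ 0 := by
  intro h
  have := coeff_emb p (-(p.natDegree : ℤ))
  simp [h] at this
  exact hp (leadingCoeff_eq_zero.1 this.symm)

lemma order_emb {p : K[X]} (hp : p ≠ 0) : (emb p).order = -(p.natDegree : ℤ) := by
  apply le_antisymm
  · apply HahnSeries.order_le_of_coeff_ne_zero
    rw [coeff_emb]
    simpa using hp
  · by_contra! h
    have h1 := mt HahnSeries.coeff_order_eq_zero.1 (emb_ne_zero hp)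
    rw [coeff_emb, if_pos (by omega)] at h1
    exact h1 (coeff_eq_zero_of_natDegree_lt (by omega))

lemma coeff_emb_div_emb_eq_zero {r b : K[X]} (h : r.degree < b.degree) {j : ℤ} (hj : j ≤ 0) :
    (emb r / emb b).coeff j = 0 := by
  rcases eq_or_ne r 0 with rfl | hr
  · simp
  have hb : b ≠ 0 := by rintro rfl; simp at h
  have hb' := emb_ne_zero hb
  have hr' := emb_ne_zero hr
  have key : (emb r / emb b * emb b).order = (emb r / emb b).order + (emb b).order :=
    HahnSeries.order_mul (div_ne_zero hr' hb') hb'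
  rw [div_mul_cancel₀ _ hb', order_emb hb, order_emb hr] at key
  have := natDegree_lt_natDegree hr h
  exact HahnSeries.coeff_eq_zero_of_lt_order (by omega)

lemma emb_div_emb (a : K[X]) {b : K[X]} (hb : b ≠ 0) :
    emb a / emb b = emb (a / b) + emb (a % b) / emb b := by
  have hb' := emb_ne_zero hb
  field_simp
  rw [← map_mul, ← map_add, EuclideanDomain.div_add_mod]

lemma polyPart_emb_div_emb (a : K[X]) {b : K[X]} (hb : b ≠ 0) :
    polyPart (emb a / emb b) = a / b := by
  ext i
  rw [coeff_polyPart, emb_div_emb a hb, HahnSeries.coeff_add,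
    coeff_emb_div_emb_eq_zero (degree_mod_lt a hb) (by omega), coeff_emb]
  simp

lemma natDegree_div_eq_sub (f : K[X]) {g : K[X]} (hg : g ≠ 0) (h : g.degree ≤ f.degree) :
    (f / g).natDegree = f.natDegree - g.natDegree := by
  have hf : f ≠ 0 := by
    rintro rfl
    exact hg (by simpa using h)
  have hfg : f / g ≠ 0 := by
    rw [Ne, Polynomial.div_eq_zero_iff hg]
    exact not_lt.2 h
  have := degree_add_div hg h
  rw [degree_eq_natDegree hf, degree_eq_natDegree hg, degree_eq_natDegree hfg] at this
  have : g.natDegree + (f / g).natDegree = f.natDegree := by exact_mod_cast this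
  omega

/-- `g / f` is badly approximable by fractions with denominator of degree less than `deg f`:
every such denominator `q` satisfies `|q| * |q * (g / f) - p| ≥ |T|⁻¹` for all `p`. -/
def BadlyApprox (f g : K[X]) : Prop :=
  ∀ p q : K[X], q ≠ 0 → q.natDegree < f.natDegree →
    q * g - p * f ≠ 0 ∧ f.natDegree ≤ q.natDegree + 1 + (q * g - p * f).natDegree

lemma BadlyApprox.natDegree_le {f g : K[X]} (h : BadlyApprox f g) (hf : 0 < f.natDegree) :
    f.natDegree ≤ g.natDegree + 1 := by
  have := (h 0 1 one_ne_zero (by simpa using hf)).2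
  simp at this
  omega

lemma BadlyApprox.ne_zero {f g : K[X]} (h : BadlyApprox f g) (hf : 0 < f.natDegree) :
    g ≠ 0 := by
  simpa using (h 0 1 one_ne_zero (by simpa using hf)).1

lemma BadlyApprox.mod_self {f g : K[X]} (h : BadlyApprox f g) : BadlyApprox f (g % f) := by
  intro p q hq hqf
  have e : q * (g % f) - p * f = q * g - (p + q * (g / f)) * f := by
    linear_combination q * EuclideanDomain.div_add_mod g f
  rw [e]
  exact h _ q hq hqf

lemma BadlyApprox.isCoprime {f g : K[X]} (h : BadlyApprox f g) (hf : 0 < f.natDegree) :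
    IsCoprime g f := by
  classical
  rw [← EuclideanDomain.gcd_isUnit_iff]
  obtain ⟨a, ha⟩ := EuclideanDomain.gcd_dvd_left g f
  obtain ⟨b, hb⟩ := EuclideanDomain.gcd_dvd_right g f
  set e := EuclideanDomain.gcd g f
  have hf0 : f ≠ 0 := by rintro rfl; simp at hf
  have he0 : e ≠ 0 := by rintro he; simp [he] at hb; exact hf0 hb
  have hb0 : b ≠ 0 := by rintro rfl; simp at hb; exact hf0 hb
  by_contra hu
  have he : 0 < e.natDegree := by
    rw [Nat.pos_iff_ne_zero]
    intro h0
    exact hu (isUnit_iff_degree_eq_zero.2 ((degree_eq_iff_natDegree_eq he0).2 h0))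
  have hd : f.natDegree = e.natDegree + b.natDegree := by
    conv_lhs => rw [hb]
    exact natDegree_mul he0 hb0
  refine (h a b hb0 (by omega)).1 ?_
  linear_combination b * ha - a * hb

/-- Bad approximability is inherited by the next step of the Euclidean algorithm. -/
lemma BadlyApprox.mod {f g : K[X]} (h : BadlyApprox f g) (hg : g ≠ 0)
    (hgf : g.natDegree < f.natDegree) : BadlyApprox g (f % g) := by
  intro p q hq hqg
  have hdeg := h.natDegree_le (by omega)
  have hf0 : f ≠ 0 := by rintro rfl; simp at hgf
  have e : q * (f % g) - p * g = -((p + q * (f / g)) * g - q * f) := by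
    linear_combination q * EuclideanDomain.div_add_mod f g
  have hdiv : (f / g).natDegree = 1 := by
    rw [natDegree_div_eq_sub f hg (degree_lt_degree hgf).le]
    omega
  have hdiv0 : f / g ≠ 0 := by intro h0; simp [h0] at hdiv
  have hqd : (q * (f / g)).natDegree = q.natDegree + 1 := by
    rw [natDegree_mul hq hdiv0, hdiv]
  rcases le_or_gt p.natDegree q.natDegree with hp | hp
  · have hs : (p + q * (f / g)).natDegree = q.natDegree + 1 := by
      rw [natDegree_add_eq_right_of_natDegree_lt (by omega), hqd]
    have hs0 : p + q * (f / g) ≠ 0 := by intro h0; simp [h0] at hs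
    obtain ⟨h1, h2⟩ := h q _ hs0 (by omega)
    rw [e]
    refine ⟨neg_ne_zero.2 h1, ?_⟩
    rw [natDegree_neg]
    omega
  · have hp0 : p ≠ 0 := by rintro rfl; simp at hp
    have hlt : (q * (f % g)).natDegree < (p * g).natDegree := by
      rw [natDegree_mul hp0 hg]
      have h1 : (f % g).natDegree ≤ g.natDegree :=
        natDegree_le_natDegree (degree_mod_lt f hg).le
      have h2 := natDegree_mul_le (p := q) (q := f % g)
      omega
    have hn := natDegree_sub_eq_right_of_natDegree_lt hlt
    rw [natDegree_mul hp0 hg] at hn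
    refine ⟨fun h0 => ?_, by omega⟩
    rw [h0, natDegree_zero] at hn
    omega

/-- Reduction modulo `f` as a linear map. -/
def modHom (f : K[X]) : K[X] →ₗ[K] K[X] where
  toFun p := p % f
  map_add' p q := add_mod p q f
  map_smul' c p := by
    simp only [mod_def, smul_modByMonic, RingHom.id_apply]

lemma modHom_apply (f p : K[X]) : modHom f p = p % f := rfl

/-- The matrix of the linear map taking `q` of degree less than `k` to the top `k` coefficients
of the remainder of `q * g` modulo `f`. -/
def remMatrix (f : K[X]) (k : ℕ) : K[X] →ₗ[K] Matrix (Fin k) (Fin k) K where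
  toFun g := Matrix.of fun i j => (X ^ (j : ℕ) * g % f).coeff (f.natDegree - k + i)
  map_add' a b := by
    ext i j
    simp [mul_add, add_mod]
  map_smul' c a := by
    ext i j
    simp [← modHom_apply]

lemma remMatrix_mulVec (f g q : K[X]) {k : ℕ} (hq : q.natDegree < k) (i : Fin k) :
    (remMatrix f k g).mulVec (fun j => q.coeff j) i =
      (q * g % f).coeff (f.natDegree - k + i) := by
  simp only [Matrix.mulVec, dotProduct]
  rw [← modHom_apply]
  conv_rhs => rw [q.as_sum_range' k hq, Finset.sum_mul, map_sum, finsetSum_coeff,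
    Finset.sum_range]
  refine Finset.sum_congr rfl fun j _ => ?_
  rw [← smul_X_eq_monomial, smul_mul_assoc, map_smul, coeff_smul, smul_eq_mul, mul_comm]
  rfl

lemma det_remMatrix_X_pow {f : K[X]} {k : ℕ} (hk0 : 0 < k) (hk : k ≤ f.natDegree) :
    (remMatrix f k (X ^ (f.natDegree - k))).det = 1 := by
  have hf : f ≠ 0 := by rintro rfl; simp at hk; omega
  suffices h : remMatrix f k (X ^ (f.natDegree - k)) = 1 by rw [h, Matrix.det_one]
  ext i j
  have hm : (X ^ (j : ℕ) * X ^ (f.natDegree - k) : K[X]) % f =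
      X ^ ((j : ℕ) + (f.natDegree - k)) := by
    rw [← pow_add, mod_eq_self_iff hf, degree_X_pow, degree_eq_natDegree hf]
    exact_mod_cast (by omega)
  simp only [remMatrix, LinearMap.coe_mk, AddHom.coe_mk, Matrix.of_apply, hm, coeff_X_pow,
    Matrix.one_apply, Fin.ext_iff]
  congr 1
  exact propext (by omega)

lemma badlyApprox_of_det_ne_zero {f g : K[X]}
    (h : ∀ k ∈ Finset.Icc 1 f.natDegree, (remMatrix f k g).det ≠ 0) : BadlyApprox f g := by
  intro p q hq hqf
  by_contra hcon
  have hf : f ≠ 0 := by rintro rfl; simp at hqf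
  set s := q * g - p * f with hs
  have hc : ∀ i, f.natDegree - (q.natDegree + 1) ≤ i → s.coeff i = 0 := by
    intro i hi
    by_contra hi0
    refine hcon ⟨fun h0 => hi0 (by simp [h0]), ?_⟩
    have := le_natDegree_of_ne_zero hi0
    omega
  have hsdeg : s.degree < f.degree := by
    rw [degree_eq_natDegree hf, degree_lt_iff_coeff_zero]
    exact fun i hi => hc i (by omega)
  have hmod : q * g % f = s := by
    have := (mod_eq_self_iff hf).2 hsdeg
    rwa [hs, sub_mod, EuclideanDomain.mod_eq_zero.2 (dvd_mul_left f p), sub_zero] at this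
  have hv := Matrix.eq_zero_of_mulVec_eq_zero (h (q.natDegree + 1) (by simp; omega))
    (v := fun j => q.coeff j) (by
      ext i
      rw [remMatrix_mulVec f g q (Nat.lt_succ_self _), hmod]
      exact hc _ (by omega))
  have := congrFun hv (Fin.last _)
  simp at this
  exact hq this

/-- Over an infinite field, finitely many determinants of matrices depending linearly on a vector
are simultaneously nonzero at some vector as soon as each of them is nonzero somewhere. -/
lemma exists_forall_det_ne_zero [Infinite K] {V ι : Type*} [AddCommGroup V] [Module K V]
    {n : ι → ℕ} (M : ∀ k, V →ₗ[K] Matrix (Fin (n k)) (Fin (n k)) K) (s : Finset ι)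
    (h : ∀ k ∈ s, ∃ v, (M k v).det ≠ 0) : ∃ v, ∀ k ∈ s, (M k v).det ≠ 0 := by
  classical
  induction s using Finset.induction_on with
  | empty => exact ⟨0, by simp⟩
  | insert a s ha ih =>
    obtain ⟨v, hv⟩ := ih fun k hk => h k (Finset.mem_insert_of_mem hk)
    obtain ⟨w, hw⟩ := h a (Finset.mem_insert_self a s)
    let P : ι → K[X] := fun k =>
      ((X : K[X]) • (M k w).map C + (M k v).map C).det
    have hP : ∀ k t, (P k).eval t = (M k (t • w + v)).det := by
      intro k t
      rw [← coe_evalRingHom, RingHom.map_det]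
      congr 1
      ext i j
      simp only [RingHom.mapMatrix_apply, Matrix.map_apply, Matrix.add_apply, Matrix.smul_apply,
        smul_eq_mul, coe_evalRingHom, eval_mul, eval_X, eval_C, map_add, map_smul]
    have hP0 : ∏ k ∈ insert a s, P k ≠ 0 := by
      rw [Finset.prod_ne_zero_iff]
      intro k hk h0
      rcases Finset.mem_insert.1 hk with rfl | hk
      · have := coeff_det_X_add_C_card (M k w) (M k v)
        exact hw (by rw [← this]; simpa [P] using congrArg (fun p => coeff p _) h0)
      · apply hv k hk
        have := hP k 0
        simpa [h0] using this.symm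
    obtain ⟨t, ht⟩ : ∃ t, (∏ k ∈ insert a s, P k).eval t ≠ 0 := by
      by_contra! hcon
      exact hP0 (Polynomial.funext fun t => by simpa using hcon t)
    rw [eval_prod, Finset.prod_ne_zero_iff] at ht
    exact ⟨t • w + v, fun k hk => by rw [← hP]; exact ht k hk⟩

lemma exists_badlyApprox [Infinite K] (f : K[X]) : ∃ g, BadlyApprox f g := by
  obtain ⟨g, hg⟩ := exists_forall_det_ne_zero (n := id) (fun k => remMatrix f k)
    (Finset.Icc 1 f.natDegree) fun k hk => by
      rw [Finset.mem_Icc] at hk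
      exact ⟨_, by rw [det_remMatrix_X_pow (by omega) hk.2]; exact one_ne_zero⟩
  exact ⟨g, badlyApprox_of_det_ne_zero hg⟩

lemma cq_one_emb_div {f g : K[X]} (hgf : g.degree < f.degree) :
    cq (emb g / emb f) 1 = emb f / emb g := by
  have hf : f ≠ 0 := by rintro rfl; simp at hgf
  simp [cq, polyPart_emb_div_emb g hf, (Polynomial.div_eq_zero_iff hf).2 hgf]

lemma BadlyApprox.cq_succ {f g : K[X]} (h : BadlyApprox f g) (hg : g ≠ 0)
    (hgf : g.degree < f.degree) (n : ℕ) :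
    cq (emb g / emb f) (n + 1) = 0 ∨ ∃ a b : K[X], b ≠ 0 ∧ b.degree < a.degree ∧
      BadlyApprox a b ∧ cq (emb g / emb f) (n + 1) = emb a / emb b := by
  induction n with
  | zero => exact Or.inr ⟨f, g, hg, hgf, h, cq_one_emb_div hgf⟩
  | succ n ih =>
    rw [cq]
    rcases ih with h0 | ⟨a, b, hb, hba, hab, heq⟩
    · left
      rw [h0]
      have : polyPart (0 : LaurentSeries K) = 0 := by ext i; simp [coeff_polyPart]
      simp [this]
    · rw [heq, polyPart_emb_div_emb a hb, emb_div_emb a hb, add_sub_cancel_left, inv_div]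
      by_cases hr : a % b = 0
      · left; simp [hr]
      · exact Or.inr ⟨b, a % b, hr, degree_mod_lt a hb,
          hab.mod hb (natDegree_lt_natDegree hb hba), rfl⟩

lemma BadlyApprox.KK_eq_one {f g : K[X]} (h : BadlyApprox f g) (hg : g ≠ 0)
    (hgf : g.degree < f.degree) : KK (emb g / emb f) = 1 := by
  have key : ∀ a b : K[X], b ≠ 0 → b.degree < a.degree → BadlyApprox a b →
      (polyPart (emb a / emb b)).natDegree = 1 := by
    intro a b hb hba hab
    rw [polyPart_emb_div_emb a hb, natDegree_div_eq_sub _ hb hba.le]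
    have h1 := natDegree_lt_natDegree hb hba
    have h2 := hab.natDegree_le (by omega)
    omega
  have hf : f ≠ 0 := by rintro rfl; simp at hgf
  apply le_antisymm
  · refine iSup_le ?_
    rintro ⟨n, hn, hne⟩
    obtain ⟨m, rfl⟩ := Nat.exists_eq_add_of_le' hn
    rcases h.cq_succ hg hgf m with h0 | ⟨a, b, hb, hba, hab, heq⟩
    · exact absurd h0 hne
    · simp only [pq, heq, key a b hb hba hab, Nat.cast_one, le_refl]
  · have h1 := cq_one_emb_div hgf
    refine le_iSup_of_le ⟨1, le_rfl, ?_⟩ ?_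
    · rw [h1]
      exact div_ne_zero (emb_ne_zero hf) (emb_ne_zero hg)
    · simp only [pq, h1, key f g hg hgf h, Nat.cast_one, le_refl]

end PaperCF

open PaperCF in
/-- Zaremba's polynomial conjecture with constant 1 over infinite fields:
if `K` is infinite, every non-constant `f ∈ K[T]` admits `g` coprime to `f` with `g/f`
normal. -/
theorem zaremba_infinite_field {K : Type*} [Field K] [Infinite K] (f : Polynomial K)
    (hf : 0 < f.natDegree) :
    ∃ g : Polynomial K, IsCoprime g f ∧ KK (emb g / emb f) = 1 := by
  obtain ⟨g, hg⟩ := exists_badlyApprox f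
  have hf0 : f ≠ 0 := by rintro rfl; simp at hf
  have hg' := hg.mod_self
  exact ⟨g % f, hg'.isCoprime hf,
    hg'.KK_eq_one (hg'.ne_zero hf) (Polynomial.degree_mod_lt g hf0)⟩
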